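/- Let a₁, a₂, a₃ be real numbers, let c = c(a,b) be the three-dimensional unimodular structure constants with b₁ = b₂ = b₃ = 0 (Case I), and let f, g, h : ℝ → ℝ be differentiable functions that are nowhere zero. Then the curve Q(t) = diag(f(t), g(t), h(t)) satisfies the reduced Ricci flow equation Q(t)⁻¹ * Q'(t) + (Q(t)⁻¹ * Q'(t))ᵀ = 2 · R(T_Λ(Q(t))c) for all t if and only if, for all t: f'(t)/f(t) = a₂a₃f(t)² + a₁²g(t)²h(t)²/(2f(t)²) − f(t)²(a₃²g(t)⁴ + a₂²h(t)⁴)/(2g(t)²h(t)²), g'(t)/g(t) = a₁a₃g(t)² + a₂²f(t)²h(t)²/(2g(t)²) − g(t)²(a₃²f(t)⁴ + a₁²h(t)⁴)/(2f(t)²h(t)²), and h'(t)/h(t) = (a₃²f(t)⁴g(t)⁴ − (a₂f(t)² − a₁g(t)²)²h(t)⁴)/(2f(t)²g(t)²h(t)²). -/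

import Mathlib

open Matrix BigOperators

noncomputable section

/-- The structure constants of a three-dimensional unimodular Lie algebra, with
parameters `a₁ a₂ a₃ b₁ b₂ b₃`: `cab a₁ a₂ a₃ b₁ b₂ b₃ k i j = C^k_{ij}`, whose only
nonzero entries are `C¹₂₃ = a₁`, `C²₃₁ = a₂`, `C³₁₂ = a₃`, `C¹₁₂ = C³₂₃ = b₁`,
`C¹₃₁ = C²₂₃ = b₂`, `C²₁₂ = C³₃₁ = b₃` and those forced by skew-symmetry. -/
def cab (a₁ a₂ a₃ b₁ b₂ b₃ : ℝ) : Fin 3 → Fin 3 → Fin 3 → ℝ :=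
  fun k i j =>
    ![!![0, b₁, -b₂; -b₁, 0, a₁; b₂, -a₁, 0],
      !![0, b₃, -a₂; -b₃, 0, b₂; a₂, -b₂, 0],
      !![0, a₃, -b₃; -a₃, 0, b₁; b₃, -b₁, 0]] k i j

/-- First piece of the Ricci tensor: `R¹(c) j k = -(1/2) Σ_{s,m} c s m j * c m s k`. -/
def R1 (c : Fin 3 → Fin 3 → Fin 3 → ℝ) (j k : Fin 3) : ℝ :=
  -(1/2) * ∑ s, ∑ m, c s m j * c m s k

/-- Second piece: `R²(c) j k = (1/2) Σ_{s,m} c m m s * (c k s j + c j s k)`. -/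
def R2 (c : Fin 3 → Fin 3 → Fin 3 → ℝ) (j k : Fin 3) : ℝ :=
  (1/2) * ∑ s, ∑ m, c m m s * (c k s j + c j s k)

/-- Third piece: `R³(c) j k = (1/4) Σ_{s,m} c j s m * c k s m`. -/
def R3 (c : Fin 3 → Fin 3 → Fin 3 → ℝ) (j k : Fin 3) : ℝ :=
  (1/4) * ∑ s, ∑ m, c j s m * c k s m

/-- Fourth piece: `R⁴(c) j k = -(1/2) Σ_{s,m} c m s j * c m s k`. -/
def R4 (c : Fin 3 → Fin 3 → Fin 3 → ℝ) (j k : Fin 3) : ℝ :=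
  -(1/2) * ∑ s, ∑ m, c m s j * c m s k

/-- The Ricci matrix `R(c) = R¹(c) + R²(c) + R³(c) + R⁴(c)`. -/
def Rtot (c : Fin 3 → Fin 3 → Fin 3 → ℝ) : Matrix (Fin 3) (Fin 3) ℝ :=
  Matrix.of fun j k => R1 c j k + R2 c j k + R3 c j k + R4 c j k

/-- The action of `GL(3)` on structure constants:
`(T_Λ(Q)c) k i j = Σ_{s,m,l} Q s i * Q m j * c l s m * (Q⁻¹) k l`. -/
def TLam (Q : Matrix (Fin 3) (Fin 3) ℝ) (c : Fin 3 → Fin 3 → Fin 3 → ℝ) :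
    Fin 3 → Fin 3 → Fin 3 → ℝ :=
  fun k i j => ∑ s, ∑ m, ∑ l, Q s i * Q m j * c l s m * Q⁻¹ k l

/-- Entrywise derivative of a curve of matrices. -/
def mderiv (Q : ℝ → Matrix (Fin 3) (Fin 3) ℝ) (t : ℝ) : Matrix (Fin 3) (Fin 3) ℝ :=
  Matrix.of fun i j => deriv (fun s => Q s i j) t

/-- On a diagonal matrix, `TLam` rescales each structure constant. -/
lemma TLam_diagonal (x : Fin 3 → ℝ) (hx : ∀ i, x i ≠ 0)
    (c : Fin 3 → Fin 3 → Fin 3 → ℝ) :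
    TLam (Matrix.diagonal x) c = fun k i j => x i * x j * c k i j * (x k)⁻¹ := by
  have hinv : (Matrix.diagonal x)⁻¹ = Matrix.diagonal fun i => (x i)⁻¹ := by
    apply Matrix.inv_eq_right_inv
    rw [Matrix.diagonal_mul_diagonal, ← Matrix.diagonal_one]
    congr 1
    funext i
    exact mul_inv_cancel₀ (hx i)
  funext k i j
  simp [TLam, hinv, Matrix.diagonal_apply]

/-- The Case I structure constants transformed by a diagonal matrix are again of Case I. -/
lemma TLam_diagonal_cab (a₁ a₂ a₃ x y z : ℝ) (hx : x ≠ 0) (hy : y ≠ 0) (hz : z ≠ 0) :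
    TLam (Matrix.diagonal ![x, y, z]) (cab a₁ a₂ a₃ 0 0 0) =
      cab (a₁ * y * z / x) (a₂ * x * z / y) (a₃ * x * y / z) 0 0 0 := by
  rw [TLam_diagonal _ (by intro i; fin_cases i <;> simpa)]
  funext k i j
  fin_cases k <;> fin_cases i <;> fin_cases j <;> simp [cab] <;> ring

/-- The Ricci matrix of the Case I structure constants is diagonal. -/
lemma Rtot_cab (A B C : ℝ) :
    Rtot (cab A B C 0 0 0) = Matrix.diagonal
      ![(A ^ 2 - (B - C) ^ 2) / 2, (B ^ 2 - (A - C) ^ 2) / 2, (C ^ 2 - (A - B) ^ 2) / 2] := by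
  ext i j
  fin_cases i <;> fin_cases j <;>
    simp [Rtot, R1, R2, R3, R4, cab, Fin.sum_univ_three] <;> ring

/-- The entrywise derivative of a diagonal curve is diagonal. -/
lemma mderiv_diagonal (f g h : ℝ → ℝ) (Q : ℝ → Matrix (Fin 3) (Fin 3) ℝ)
    (hQ : ∀ t, Q t = Matrix.diagonal ![f t, g t, h t]) (t : ℝ) :
    mderiv Q t = Matrix.diagonal ![deriv f t, deriv g t, deriv h t] := by
  ext i j
  fin_cases i <;> fin_cases j <;> simp [mderiv, hQ]

/-- In Case I, the curve `Q(t) = diag(f(t), g(t), h(t))` satisfies the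
reduced Ricci flow equation iff `f, g, h` solve the stated ODE system. -/
theorem ricci_flow_case_I (a₁ a₂ a₃ : ℝ) (f g h : ℝ → ℝ)
    (hfd : Differentiable ℝ f) (hgd : Differentiable ℝ g) (hhd : Differentiable ℝ h)
    (hf : ∀ t, f t ≠ 0) (hg : ∀ t, g t ≠ 0) (hh : ∀ t, h t ≠ 0)
    (Q : ℝ → Matrix (Fin 3) (Fin 3) ℝ)
    (hQ : ∀ t, Q t = Matrix.diagonal ![f t, g t, h t]) :
    (∀ t, (Q t)⁻¹ * mderiv Q t + ((Q t)⁻¹ * mderiv Q t)ᵀ =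
        (2 : ℝ) • Rtot (TLam (Q t) (cab a₁ a₂ a₃ 0 0 0))) ↔
    (∀ t,
      deriv f t / f t =
        a₂*a₃*(f t)^2 + a₁^2*(g t)^2*(h t)^2/(2*(f t)^2)
          - (f t)^2*(a₃^2*(g t)^4 + a₂^2*(h t)^4)/(2*(g t)^2*(h t)^2) ∧
      deriv g t / g t =
        a₁*a₃*(g t)^2 + a₂^2*(f t)^2*(h t)^2/(2*(g t)^2)
          - (g t)^2*(a₃^2*(f t)^4 + a₁^2*(h t)^4)/(2*(f t)^2*(h t)^2) ∧
      deriv h t / h t =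
        (a₃^2*(f t)^4*(g t)^4 - (a₂*(f t)^2 - a₁*(g t)^2)^2*(h t)^4)
          / (2*(f t)^2*(g t)^2*(h t)^2)) := by
  refine forall_congr' fun t => ?_
  have hft := hf t
  have hgt := hg t
  have hht := hh t
  have hinv : (Q t)⁻¹ = Matrix.diagonal ![(f t)⁻¹, (g t)⁻¹, (h t)⁻¹] := by
    apply Matrix.inv_eq_right_inv
    rw [hQ, Matrix.diagonal_mul_diagonal, ← Matrix.diagonal_one]
    congr 1
    funext i
    fin_cases i <;> simp [hft, hgt, hht]
  rw [hinv, mderiv_diagonal f g h Q hQ, hQ, TLam_diagonal_cab _ _ _ _ _ _ hft hgt hht, Rtot_cab,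
    Matrix.diagonal_mul_diagonal, Matrix.diagonal_transpose, Matrix.diagonal_add,
    ← Matrix.diagonal_smul, Matrix.diagonal_injective.eq_iff, funext_iff, Fin.forall_fin_succ,
    Fin.forall_fin_succ, Fin.forall_fin_succ]
  have halve : ∀ {p q r : ℝ}, q = r → (p + p = 2 * q ↔ p = r) := by
    rintro p q r rfl
    constructor <;> intro H <;> linarith
  simp only [IsEmpty.forall_iff, and_true, div_eq_inv_mul (deriv _ _)]
  refine and_congr (halve ?_) (and_congr (halve ?_) (halve ?_)) <;>
  · simp
    field_simp
    ring
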